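/- arXiv:1910.10074 — 3 statements merged into one kernel-verified Lean document; each statement's English description precedes it below -/
import Mathlib

section
/- Let k ≥ 3, let N ≥ 1 be an integer, and let A ⊆ {1,...,N} be a nonempty set containing no k-term arithmetic progression of integers. For j ∈ A define f_j : ℝ → ℝ by f_j(x) = x/(12N) + 6j/(12N), and set E = ⋂_{ℓ≥1} ⋃_{i_1,...,i_ℓ ∈ A} f_{i_1}∘f_{i_2}∘⋯∘f_{i_ℓ}([0,1]). Then E is a compact subset of [0,1], E (1/(12N))-avoids k-APs, and dim_H(E) = log(#A) / log(12N). -/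
open Set MeasureTheory
open scoped ENNReal

/-- A set `E ⊆ ℝ` `ε`-avoids `k`-term arithmetic progressions: for every `k`-AP
`P = {a + i·lam : 0 ≤ i < k}` with gap `lam > 0`, some point of `P` is at distance at least
`ε·lam` from every point of `E`. -/
def Avoids (k : ℕ) (ε : ℝ) (E : Set ℝ) : Prop :=
  ∀ a lam : ℝ, 0 < lam → ∃ i : ℕ, i < k ∧ ∀ x ∈ E, ε * lam ≤ |x - (a + i * lam)|

/-- `A` contains a `k`-term arithmetic progression of integers (gap `d ≥ 1`). -/
def ContainsAPNat (k : ℕ) (A : Finset ℕ) : Prop :=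
  ∃ a d : ℕ, 1 ≤ d ∧ ∀ i : ℕ, i < k → a + i * d ∈ A

open Filter Topology
open scoped NNReal

/-- The image of `[0, 1]` under the composition of the maps `f j` along the word `w`. -/
def wordCylinder (f : ℕ → ℝ → ℝ) (w : List ℕ) : Set ℝ :=
  (w.map f).foldr (· ∘ ·) id '' Set.Icc (0 : ℝ) 1

/-- The union of the cylinders of all words of length `ℓ` over the alphabet `A`. -/
def cylinderUnion (f : ℕ → ℝ → ℝ) (A : Finset ℕ) (ℓ : ℕ) : Set ℝ :=
  ⋃ (w : List ℕ) (_ : w.length = ℓ ∧ ∀ j ∈ w, j ∈ A), wordCylinder f w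

theorem wordCylinder_nil (f : ℕ → ℝ → ℝ) : wordCylinder f [] = Icc 0 1 := by
  simp [wordCylinder]

theorem wordCylinder_cons (f : ℕ → ℝ → ℝ) (j : ℕ) (w : List ℕ) :
    wordCylinder f (j :: w) = f j '' wordCylinder f w := by
  simp [wordCylinder, image_comp]

theorem mem_cylinderUnion {f : ℕ → ℝ → ℝ} {A : Finset ℕ} {ℓ : ℕ} {x : ℝ} :
    x ∈ cylinderUnion f A ℓ ↔
      ∃ w : List ℕ, (w.length = ℓ ∧ ∀ j ∈ w, j ∈ A) ∧ x ∈ wordCylinder f w := by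
  simp [cylinderUnion]

theorem cylinderUnion_zero (f : ℕ → ℝ → ℝ) (A : Finset ℕ) :
    cylinderUnion f A 0 = Icc 0 1 := by
  ext x
  rw [mem_cylinderUnion]
  constructor
  · rintro ⟨w, ⟨hw, -⟩, hx⟩
    rw [List.length_eq_zero_iff] at hw
    rwa [hw, wordCylinder_nil] at hx
  · intro hx
    exact ⟨[], by simp, by rwa [wordCylinder_nil]⟩

theorem cylinderUnion_succ (f : ℕ → ℝ → ℝ) (A : Finset ℕ) (ℓ : ℕ) :
    cylinderUnion f A (ℓ + 1) = ⋃ j ∈ A, f j '' cylinderUnion f A ℓ := by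
  ext x
  simp only [mem_cylinderUnion, mem_iUnion, mem_image, exists_prop]
  constructor
  · rintro ⟨w, ⟨hw, hwA⟩, hx⟩
    cases w with
    | nil => simp at hw
    | cons j w =>
      rw [wordCylinder_cons] at hx
      obtain ⟨y, hy, rfl⟩ := hx
      exact ⟨j, hwA j (by simp), y,
        ⟨w, ⟨by simpa using hw, fun i hi => hwA i (by simp [hi])⟩, hy⟩, rfl⟩
  · rintro ⟨j, hj, y, ⟨w, ⟨hw, hwA⟩, hy⟩, rfl⟩
    refine ⟨j :: w, ⟨by simp [hw], ?_⟩, ?_⟩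
    · intro i hi
      rcases List.mem_cons.1 hi with rfl | hi
      · exact hj
      · exact hwA i hi
    · rw [wordCylinder_cons]
      exact mem_image_of_mem _ hy

theorem isCompact_cylinderUnion {f : ℕ → ℝ → ℝ} (hf : ∀ j, Continuous (f j)) (A : Finset ℕ)
    (ℓ : ℕ) : IsCompact (cylinderUnion f A ℓ) := by
  induction ℓ with
  | zero => rw [cylinderUnion_zero]; exact isCompact_Icc
  | succ ℓ ih =>
    rw [cylinderUnion_succ]
    exact A.isCompact_biUnion fun j _ => ih.image (hf j)

theorem ediam_wordCylinder_le {f : ℕ → ℝ → ℝ} {K : ℝ≥0} (hf : ∀ j, LipschitzWith K (f j))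
    (w : List ℕ) : Metric.ediam (wordCylinder f w) ≤ (K : ℝ≥0∞) ^ w.length := by
  induction w with
  | nil => simp [wordCylinder_nil]
  | cons j w ih =>
    rw [wordCylinder_cons, List.length_cons, pow_succ']
    exact ((hf j).ediam_image_le _).trans (by gcongr)

/-- A set covered at every scale by the cylinders of a system of `K`-Lipschitz maps has Hausdorff
dimension at most the similarity dimension `s`. -/
theorem dimH_le_of_subset_cylinderUnion {f : ℕ → ℝ → ℝ} {A : Finset ℕ} {K s : ℝ≥0}
    (hf : ∀ j, LipschitzWith K (f j)) (hK : K < 1) (hs : A.card * K ^ (s : ℝ) = 1)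
    {E : Set ℝ} (hE : ∀ ℓ, E ⊆ cylinderUnion f A ℓ) : dimH E ≤ s := by
  apply dimH_le_of_hausdorffMeasure_ne_top
  refine ne_top_of_le_ne_top ENNReal.one_ne_top ?_
  have key := Measure.hausdorffMeasure_le_liminf_sum (ι := fun ℓ : ℕ => Fin ℓ → A) (s : ℝ) E
    (l := atTop) (fun ℓ => (K : ℝ≥0∞) ^ ℓ)
    (ENNReal.tendsto_pow_atTop_nhds_zero_of_lt_one (by exact_mod_cast hK))
    (fun ℓ w => wordCylinder f (List.ofFn fun i => (w i : ℕ)))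
    (Eventually.of_forall fun ℓ w => by
      simpa using ediam_wordCylinder_le hf (List.ofFn fun i => (w i : ℕ)))
    (Eventually.of_forall fun ℓ x hx => by
      obtain ⟨w, ⟨hw, hwA⟩, hx⟩ := mem_cylinderUnion.1 (hE ℓ hx)
      subst hw
      refine mem_iUnion.2 ⟨fun i => ⟨w.get i, hwA _ (by simp)⟩, ?_⟩
      simpa [List.ofFn_get] using hx)
  refine key.trans ?_
  refine (liminf_le_liminf (v := fun _ => 1) (Eventually.of_forall fun ℓ => ?_)).trans (by simp)
  calc ∑ w : Fin ℓ → A,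
        Metric.ediam (wordCylinder f (List.ofFn fun i => (w i : ℕ))) ^ (s : ℝ)
      ≤ ∑ w : Fin ℓ → A, ((K : ℝ≥0∞) ^ ℓ) ^ (s : ℝ) := by
        gcongr with w
        simpa using ediam_wordCylinder_le hf (List.ofFn fun i => (w i : ℕ))
    _ = ((A.card * K ^ (s : ℝ) : ℝ≥0) : ℝ≥0∞) ^ ℓ := by
        rw [Finset.sum_const, Finset.card_univ, nsmul_eq_mul, Fintype.card_fun, Fintype.card_coe,
          Fintype.card_fin, ENNReal.coe_mul, mul_pow, ENNReal.coe_rpow_of_nonneg _ s.coe_nonneg,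
          ← ENNReal.rpow_natCast, ← ENNReal.rpow_mul, mul_comm (ℓ : ℝ), ENNReal.rpow_mul,
          ENNReal.rpow_natCast]
        simp
    _ ≤ 1 := by rw [hs]; simp

theorem ofDigits_eq_add_shift {b : ℕ} (d : ℕ → Fin b) :
    Real.ofDigits d = ((d 0 : ℕ) : ℝ) / b + Real.ofDigits (fun i => d (i + 1)) / b := by
  rw [Real.ofDigits_eq_sum_add_ofDigits d 1]
  simp [Real.ofDigitsTerm, div_eq_mul_inv, mul_comm]

/-- If digits in base `b` are spread out by `σ` to non-adjacent digits in base `M`, then the number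
read in base `b` is a Hölder function of the number read in base `M`. -/
theorem abs_ofDigits_sub_le_rpow {b M : ℕ} (hM : 0 < M) {σ : Fin b → Fin M}
    (hσ : ∀ i j, i ≠ j → (2 : ℝ) ≤ |((σ i : ℕ) : ℝ) - (σ j : ℕ)|) {s : ℝ} (hs : 0 ≤ s)
    (hMs : (M : ℝ) ^ s = b) (d e : ℕ → Fin b) :
    |Real.ofDigits d - Real.ofDigits e| ≤
      b * |Real.ofDigits (fun i => σ (d i)) - Real.ofDigits (fun i => σ (e i))| ^ s := by
  have hM' : (0 : ℝ) < M := by exact_mod_cast hM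
  have hb : (0 : ℝ) < b := hMs ▸ Real.rpow_pos_of_pos hM' s
  have hzero : ∀ d e : ℕ → Fin b, d 0 ≠ e 0 → |Real.ofDigits d - Real.ofDigits e| ≤
      b * |Real.ofDigits (fun i => σ (d i)) - Real.ofDigits (fun i => σ (e i))| ^ s := by
    intro d e hde
    have h1 : |Real.ofDigits d - Real.ofDigits e| ≤ 1 := by
      rw [abs_le]
      constructor <;> linarith [Real.ofDigits_nonneg d, Real.ofDigits_nonneg e,
        Real.ofDigits_le_one d, Real.ofDigits_le_one e]
    refine h1.trans ?_
    rw [← hMs, ← Real.mul_rpow hM'.le (abs_nonneg _)]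
    apply Real.one_le_rpow _ hs
    rw [ofDigits_eq_add_shift (fun i => σ (d i)), ofDigits_eq_add_shift (fun i => σ (e i)),
      ← abs_of_pos hM', ← abs_mul, abs_of_pos hM']
    set u := Real.ofDigits (fun i => σ (d (i + 1)))
    set v := Real.ofDigits (fun i => σ (e (i + 1)))
    have huv : |v - u| ≤ 1 := by
      rw [abs_le]
      constructor <;> linarith [Real.ofDigits_nonneg (fun i => σ (d (i + 1))),
        Real.ofDigits_nonneg (fun i => σ (e (i + 1))),
        Real.ofDigits_le_one (fun i => σ (d (i + 1))),
        Real.ofDigits_le_one (fun i => σ (e (i + 1)))]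
    have : (M : ℝ) * (((σ (d 0) : ℕ) : ℝ) / M + u / M - (((σ (e 0) : ℕ) : ℝ) / M + v / M)) =
        (((σ (d 0) : ℕ) : ℝ) - (σ (e 0) : ℕ)) - (v - u) := by
      field_simp
      ring
    rw [this]
    linarith [abs_sub_abs_le_abs_sub (((σ (d 0) : ℕ) : ℝ) - (σ (e 0) : ℕ)) (v - u),
      hσ _ _ hde]
  have main : ∀ (m : ℕ) (d e : ℕ → Fin b), d m ≠ e m → |Real.ofDigits d - Real.ofDigits e| ≤
      b * |Real.ofDigits (fun i => σ (d i)) - Real.ofDigits (fun i => σ (e i))| ^ s := by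
    intro m
    induction m with
    | zero => exact hzero
    | succ m ih =>
      intro d e hde
      by_cases h0 : d 0 = e 0
      · have := ih (fun i => d (i + 1)) (fun i => e (i + 1)) hde
        rw [ofDigits_eq_add_shift d, ofDigits_eq_add_shift e,
          ofDigits_eq_add_shift (fun i => σ (d i)), ofDigits_eq_add_shift (fun i => σ (e i)), h0,
          add_sub_add_left_eq_sub, add_sub_add_left_eq_sub, ← sub_div, ← sub_div, abs_div, abs_div,
          abs_of_pos hM', abs_of_pos hb, Real.div_rpow (abs_nonneg _) hM'.le, hMs, ← mul_div_assoc]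
        gcongr
      · exact hzero d e h0
  by_cases hde : d = e
  · rw [hde, sub_self, abs_zero]
    positivity
  · obtain ⟨m, hm⟩ := Function.ne_iff.1 hde
    exact main m d e hm

/-- A set containing all numbers whose base-`M` digits are spread out from base-`b` digits by `σ`
has Hausdorff dimension at least `log b / log M`. -/
theorem le_dimH_of_range_ofDigits_subset {b M : ℕ} (hM : 0 < M) (hb : 1 < b) {σ : Fin b → Fin M}
    (hσ : ∀ i j, i ≠ j → (2 : ℝ) ≤ |((σ i : ℕ) : ℝ) - (σ j : ℕ)|) {s : ℝ≥0} (hs : 0 < s)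
    (hMs : (M : ℝ) ^ (s : ℝ) = b) {E : Set ℝ}
    (hE : ∀ d : ℕ → Fin b, Real.ofDigits (fun i => σ (d i)) ∈ E) : (s : ℝ≥0∞) ≤ dimH E := by
  have : NeZero b := ⟨by omega⟩
  have hbound := abs_ofDigits_sub_le_rpow hM hσ s.coe_nonneg hMs
  set p : (ℕ → Fin b) → ℝ := fun d => Real.ofDigits (fun i => σ (d i)) with hp
  set g : ℝ → ℝ := fun x => Real.ofDigits (Function.invFun p x) with hg
  have hgp : ∀ d, g (p d) = Real.ofDigits d := by
    intro d
    have h1 : p (Function.invFun p (p d)) = p d := Function.invFun_eq ⟨d, rfl⟩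
    have h2 := hbound (Function.invFun p (p d)) d
    change _ ≤ (b : ℝ) * |p _ - p d| ^ (s : ℝ) at h2
    rw [h1, sub_self, abs_zero, Real.zero_rpow (by exact_mod_cast hs.ne'), mul_zero] at h2
    exact sub_eq_zero.1 (abs_nonpos_iff.1 h2)
  have hH : HolderOnWith (b : ℝ≥0) s g (range p) := by
    rintro _ ⟨d, rfl⟩ _ ⟨e, rfl⟩
    rw [hgp, hgp, edist_dist, edist_dist, Real.dist_eq, Real.dist_eq,
      ENNReal.ofReal_rpow_of_nonneg (abs_nonneg _) s.coe_nonneg, ← ENNReal.ofReal_coe_nnreal,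
      ← ENNReal.ofReal_mul (by positivity)]
    exact ENNReal.ofReal_le_ofReal (by simpa using hbound d e)
  have himg : Icc (0 : ℝ) 1 ⊆ g '' range p := by
    intro y hy
    obtain ⟨d, -, rfl⟩ := Real.ofDigits_SurjOn hb hy
    exact ⟨p d, ⟨d, rfl⟩, hgp d⟩
  have h1 : (1 : ℝ≥0∞) ≤ dimH (range p) / s := by
    refine le_trans ?_ ((dimH_mono himg).trans (hH.dimH_image_le hs))
    rw [Real.dimH_of_nonempty_interior (by simp)]
    simp
  rw [ENNReal.le_div_iff_mul_le (Or.inl (by exact_mod_cast hs.ne')) (Or.inl ENNReal.coe_ne_top),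
    one_mul] at h1
  exact h1.trans (dimH_mono (range_subset_iff.2 hE))

/-- A `k`-term progression of gap `lam` approximated by points of a self-similar set has its
points in one piece, and rescales to a progression of gap `12 * N * lam`. -/
theorem avoids_of_self_similar {k N : ℕ} (hk : 3 ≤ k) (hN : 1 ≤ N) {A : Finset ℕ}
    (hnoAP : ¬ ContainsAPNat k A) {E : Set ℝ} (hE01 : E ⊆ Icc 0 1)
    (hE : ∀ x ∈ E, ∃ j ∈ A, ∃ t ∈ E, x = t / (12 * N) + 6 * j / (12 * N)) :
    Avoids k (1 / (12 * N)) E := by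
  have hN' : (1 : ℝ) ≤ N := by exact_mod_cast hN
  have hM : (0 : ℝ) < 12 * N := by positivity
  set M : ℝ := 12 * N with hMdef
  have hM12 : 12 ≤ M := by linarith
  -- A counterexample of gap `lam` yields one of gap `M * lam`, while gaps are bounded by `1`.
  have hbd : ∀ a lam : ℝ, 0 < lam → (∀ i < k, ∃ x ∈ E, |x - (a + i * lam)| < 1 / M * lam) →
      lam < 1 := by
    intro a lam hl h
    obtain ⟨x, hx, hx'⟩ := h 0 (by omega)
    obtain ⟨y, hy, hy'⟩ := h 2 (by omega)
    have h1 : 1 / M * lam ≤ lam / 12 := by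
      rw [one_div_mul_eq_div]; gcongr
    rw [abs_lt] at hx' hy'
    push_cast at hx' hy'
    have := hE01 hx
    have := hE01 hy
    simp only [mem_Icc] at *
    linarith
  have hstep : ∀ a lam : ℝ, 0 < lam → (∀ i < k, ∃ x ∈ E, |x - (a + i * lam)| < 1 / M * lam) →
      ∃ a', ∀ i < k, ∃ x ∈ E, |x - (a' + i * (M * lam))| < 1 / M * (M * lam) := by
    intro a lam hl h
    have hl1 := hbd a lam hl h
    have h' : ∀ i : ℕ, ∃ j : ℕ, ∃ t : ℝ, i < k → j ∈ A ∧ t ∈ E ∧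
        |t + 6 * j - (M * a + i * (M * lam))| < lam := by
      intro i
      by_cases hi : i < k
      · obtain ⟨x, hx, hx'⟩ := h i hi
        obtain ⟨j, hj, t, ht, rfl⟩ := hE x hx
        refine ⟨j, t, fun _ => ⟨hj, ht, ?_⟩⟩
        have : t + 6 * j - (M * a + i * (M * lam)) =
            M * (t / M + 6 * j / M - (a + i * lam)) := by
          field_simp
        rw [this, abs_mul, abs_of_pos hM]
        calc M * _ < M * (1 / M * lam) := by gcongr
          _ = lam := by field_simp
      · exact ⟨0, 0, fun h => absurd h hi⟩
    choose j t hjt using h'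
    have hlin : ∀ i, i + 2 < k → (j (i + 2) : ℤ) - j (i + 1) = j (i + 1) - j i := by
      intro i hi
      obtain ⟨-, ht0, h0⟩ := hjt i (by omega)
      obtain ⟨-, ht1, h1⟩ := hjt (i + 1) (by omega)
      obtain ⟨-, ht2, h2⟩ := hjt (i + 2) hi
      have ht0 := hE01 ht0
      have ht1 := hE01 ht1
      have ht2 := hE01 ht2
      rw [mem_Icc] at ht0 ht1 ht2
      rw [abs_lt] at h0 h1 h2
      push_cast at h0 h1 h2
      have h3 : (j (i + 2) : ℝ) - j (i + 1) - (j (i + 1) - j i) < 1 := by linarith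
      have h4 : -1 < (j (i + 2) : ℝ) - j (i + 1) - (j (i + 1) - j i) := by linarith
      have h3' : (j (i + 2) : ℤ) - j (i + 1) - (j (i + 1) - j i) < 1 := by exact_mod_cast h3
      have h4' : -1 < (j (i + 2) : ℤ) - j (i + 1) - (j (i + 1) - j i) := by exact_mod_cast h4
      omega
    have hmono : j 0 ≤ j 1 := by
      obtain ⟨-, ht0, h0⟩ := hjt 0 (by omega)
      obtain ⟨-, ht1, h1⟩ := hjt 1 (by omega)
      have ht0 := hE01 ht0
      have ht1 := hE01 ht1
      rw [mem_Icc] at ht0 ht1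
      rw [abs_lt] at h0 h1
      push_cast at h0 h1
      have hMl : 12 * lam ≤ M * lam := by gcongr
      have h3 : (j 0 : ℝ) < j 1 + 1 := by linarith
      have h3' : j 0 < j 1 + 1 := by exact_mod_cast h3
      omega
    obtain ⟨c, hc⟩ := Nat.exists_eq_add_of_le hmono
    have hAP : ∀ i, (i + 1 < k → j i = j 0 + i * c ∧ j (i + 1) = j 0 + (i + 1) * c) := by
      intro i
      induction i with
      | zero => intro _; exact ⟨by simp, by simp [hc]⟩
      | succ i ih =>
        intro hi
        obtain ⟨h1, h2⟩ := ih (by omega)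
        refine ⟨h2, ?_⟩
        have := hlin i hi
        zify at h1 h2 ⊢
        linarith
    have hAP' : ∀ i < k, j i = j 0 + i * c := by
      intro i hi
      cases i with
      | zero => simp
      | succ i => exact (hAP i hi).2
    have hc0 : c = 0 := by
      by_contra hc0
      exact hnoAP ⟨j 0, c, by omega, fun i hi => hAP' i hi ▸ (hjt i hi).1⟩
    refine ⟨M * a - 6 * j 0, fun i hi => ⟨t i, (hjt i hi).2.1, ?_⟩⟩
    have h1 := (hjt i hi).2.2
    have h2 : j i = j 0 := by simpa [hc0] using hAP' i hi
    rw [h2] at h1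
    have h3 : 1 / M * (M * lam) = lam := by field_simp
    rw [h3]
    convert h1 using 2
    ring
  intro a lam hl
  by_contra! hcon
  have hall : ∀ n : ℕ, ∃ a', ∀ i < k, ∃ x ∈ E,
      |x - (a' + i * (M ^ n * lam))| < 1 / M * (M ^ n * lam) := by
    intro n
    induction n with
    | zero => exact ⟨a, by simpa using hcon⟩
    | succ n ih =>
      obtain ⟨a', ha'⟩ := ih
      simpa only [pow_succ', mul_assoc] using hstep a' (M ^ n * lam) (by positivity) ha'
  obtain ⟨n, hn⟩ := pow_unbounded_of_one_lt (1 / lam) (show 1 < M by linarith)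
  obtain ⟨a', ha'⟩ := hall n
  have := hbd a' _ (by positivity) ha'
  rw [div_lt_iff₀ hl] at hn
  linarith

theorem stmt1 (k N : ℕ) (hk : 3 ≤ k) (hN : 1 ≤ N) (A : Finset ℕ)
    (hA : A ⊆ Finset.Icc 1 N) (hAne : A.Nonempty) (hnoAP : ¬ ContainsAPNat k A)
    (f : ℕ → ℝ → ℝ) (hf : ∀ j x, f j x = x / (12 * N) + 6 * j / (12 * N))
    (E : Set ℝ)
    (hE : E = ⋂ (ℓ : ℕ) (_ : 1 ≤ ℓ),
        ⋃ (w : List ℕ) (_ : w.length = ℓ ∧ ∀ j ∈ w, j ∈ A),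
          (w.map f).foldr (· ∘ ·) id '' Set.Icc (0 : ℝ) 1) :
    IsCompact E ∧ E ⊆ Set.Icc (0 : ℝ) 1 ∧ Avoids k (1 / (12 * N)) E ∧
      dimH E = ENNReal.ofReal (Real.log A.card / Real.log (12 * N)) := by
  have hN' : (1 : ℝ) ≤ N := by exact_mod_cast hN
  have hM : (0 : ℝ) < 12 * N := by positivity
  have hE' : ∀ x, x ∈ E ↔ ∀ ℓ, 1 ≤ ℓ → x ∈ cylinderUnion f A ℓ := by
    intro x
    rw [hE]
    simp only [mem_iInter]
    rfl
  have hAN : ∀ j ∈ A, (1 : ℝ) ≤ j ∧ (j : ℝ) ≤ N := fun j hj => by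
    have := Finset.mem_Icc.1 (hA hj)
    exact ⟨by exact_mod_cast this.1, by exact_mod_cast this.2⟩
  have hlip : ∀ j, LipschitzWith (12 * N : ℝ≥0)⁻¹ (f j) := by
    intro j
    apply LipschitzWith.of_dist_le_mul
    intro x y
    rw [Real.dist_eq, Real.dist_eq, hf, hf, add_sub_add_right_eq_sub, ← sub_div, abs_div,
      abs_of_pos hM, div_eq_inv_mul]
    simp
  have hmaps : ∀ j ∈ A, ∀ x ∈ Icc (0 : ℝ) 1, f j x ∈ Icc (0 : ℝ) 1 := by
    intro j hj x hx
    obtain ⟨h1, h2⟩ := hAN j hj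
    rw [hf, ← add_div, mem_Icc, le_div_iff₀ hM, div_le_iff₀ hM]
    constructor <;> linarith [hx.1, hx.2]
  have hE01 : E ⊆ Icc (0 : ℝ) 1 := by
    intro x hx
    have := (hE' x).1 hx 1 le_rfl
    rw [← zero_add 1, cylinderUnion_succ, cylinderUnion_zero] at this
    simp only [mem_iUnion, mem_image, exists_prop] at this
    obtain ⟨j, hj, y, hy, rfl⟩ := this
    exact hmaps j hj y hy
  have hEall : ∀ ℓ, E ⊆ cylinderUnion f A ℓ := by
    intro ℓ x hx
    rcases Nat.eq_zero_or_pos ℓ with rfl | hℓ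
    · rw [cylinderUnion_zero]; exact hE01 hx
    · exact (hE' x).1 hx ℓ hℓ
  have hU01 : ∀ ℓ, cylinderUnion f A ℓ ⊆ Icc (0 : ℝ) 1 := by
    intro ℓ
    induction ℓ with
    | zero => rw [cylinderUnion_zero]
    | succ ℓ ih =>
      rw [cylinderUnion_succ]
      simp only [iUnion_subset_iff, image_subset_iff]
      exact fun j hj x hx => hmaps j hj x (ih hx)
  have hself : ∀ x ∈ E, ∃ j ∈ A, ∃ t ∈ E, x = t / (12 * N) + 6 * j / (12 * N) := by
    intro x hx
    have h : ∀ ℓ, ∃ j ∈ A, ∃ t ∈ cylinderUnion f A ℓ, f j t = x := by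
      intro ℓ
      have := hEall (ℓ + 1) hx
      rw [cylinderUnion_succ] at this
      simpa only [mem_iUnion, mem_image, exists_prop] using this
    obtain ⟨j, hj, t, ht, rfl⟩ := h 0
    refine ⟨j, hj, t, (hE' t).2 fun ℓ _ => ?_, hf j t⟩
    obtain ⟨i, hi, u, hu, hxu⟩ := h ℓ
    have ht01 := hU01 _ ht
    have hu01 := hU01 _ hu
    rw [hf, hf, ← add_div, ← add_div, div_left_inj' hM.ne'] at hxu
    have hij : i = j := by
      have h1 : (i : ℝ) < j + 1 := by linarith [ht01.1, ht01.2, hu01.1, hu01.2]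
      have h2 : (j : ℝ) < i + 1 := by linarith [ht01.1, ht01.2, hu01.1, hu01.2]
      have h1' : i < j + 1 := by exact_mod_cast h1
      have h2' : j < i + 1 := by exact_mod_cast h2
      omega
    subst hij
    rwa [← add_right_cancel hxu]
  have hcompact : IsCompact E := by
    refine isCompact_Icc.of_isClosed_subset ?_ hE01
    have : E = ⋂ ℓ, ⋂ (_ : 1 ≤ ℓ), cylinderUnion f A ℓ := by
      ext x; simp only [mem_iInter]; exact hE' x
    rw [this]
    exact isClosed_iInter fun ℓ => isClosed_iInter fun _ =>
      (isCompact_cylinderUnion (fun j => (hlip j).continuous) A ℓ).isClosed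
  refine ⟨hcompact, hE01, avoids_of_self_similar hk hN hnoAP hE01 hself, ?_⟩
  have hcard : 1 ≤ A.card := hAne.card_pos
  have hcard' : (1 : ℝ) ≤ A.card := by exact_mod_cast hcard
  have hs0 : 0 ≤ Real.log A.card / Real.log (12 * N) :=
    div_nonneg (Real.log_nonneg hcard') (Real.log_nonneg (by linarith))
  have hMs : (12 * N : ℝ) ^ (Real.log A.card / Real.log (12 * N)) = A.card := by
    rw [Real.log_div_log]
    exact Real.rpow_logb hM (by linarith) (by linarith)
  have hspos : 1 < A.card → 0 < Real.log A.card / Real.log (12 * N) := fun h =>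
    div_pos (Real.log_pos (by exact_mod_cast h)) (Real.log_pos (by linarith))
  generalize Real.log A.card / Real.log (12 * N) = s at hs0 hMs hspos
  lift s to ℝ≥0 using hs0
  rw [ENNReal.ofReal_coe_nnreal]
  apply le_antisymm
  · refine dimH_le_of_subset_cylinderUnion hlip ?_ ?_ hEall
    · apply inv_lt_one_of_one_lt₀
      rw [← NNReal.coe_lt_coe]
      push_cast
      linarith
    · rw [← NNReal.coe_inj]
      push_cast
      rw [Real.inv_rpow hM.le, hMs]
      exact mul_inv_cancel₀ (by linarith)
  · rcases hcard.eq_or_lt with h1 | h1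
    · have : (s : ℝ) = 0 := by
        by_contra hne
        have := Real.one_lt_rpow (show (1 : ℝ) < 12 * N by linarith)
          (s.coe_nonneg.lt_of_ne' hne)
        rw [hMs, ← h1, Nat.cast_one] at this
        exact lt_irrefl _ this
      rw [NNReal.coe_eq_zero.1 this]
      simp
    · have hσ6 : ∀ i : Fin A.card, 6 * A.orderEmbOfFin rfl i < 12 * N := fun i => by
        have := Finset.mem_Icc.1 (hA (A.orderEmbOfFin_mem rfl i))
        omega
      refine le_dimH_of_range_ofDigits_subset (M := 12 * N) (by omega) h1
        (σ := fun i => ⟨6 * A.orderEmbOfFin rfl i, hσ6 i⟩) ?_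
        (by exact_mod_cast hspos h1) (by exact_mod_cast hMs) ?_
      · intro i j hij
        have hne : A.orderEmbOfFin rfl i ≠ A.orderEmbOfFin rfl j :=
          (A.orderEmbOfFin rfl).injective.ne hij
        have : (1 : ℤ) ≤ |(A.orderEmbOfFin rfl i : ℤ) - A.orderEmbOfFin rfl j| :=
          Int.one_le_abs (sub_ne_zero.2 (by exact_mod_cast hne))
        have : (1 : ℝ) ≤ |(A.orderEmbOfFin rfl i : ℝ) - A.orderEmbOfFin rfl j| := by
          exact_mod_cast this
        push_cast
        rw [← mul_sub, abs_mul, abs_of_pos (by norm_num : (0 : ℝ) < 6)]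
        linarith
      · intro d
        refine (hE' _).2 fun ℓ _ => ?_
        clear * - hf
        induction ℓ generalizing d with
        | zero =>
          rw [cylinderUnion_zero]
          exact ⟨Real.ofDigits_nonneg _, Real.ofDigits_le_one _⟩
        | succ ℓ ih =>
          rw [cylinderUnion_succ]
          simp only [mem_iUnion, mem_image, exists_prop]
          refine ⟨_, A.orderEmbOfFin_mem rfl (d 0), _, ih (fun i => d (i + 1)), ?_⟩
          refine Eq.trans ?_ (ofDigits_eq_add_shift _).symm
          rw [hf]
          push_cast
          ring
end

section
/- For every integer k ≥ 3 and every ε ∈ (0, 1/10), one has d(k,ε) ≤ log(⌈1/ε⌉ + 1) / ( log(⌈1/ε⌉ + 1) − log(1 − 1/k) ). -/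
open Set MeasureTheory
open scoped ENNReal

/-- `d(k, ε)`: the supremum of Hausdorff dimensions of bounded sets `ε`-avoiding `k`-APs. -/
noncomputable def dAvoid (k : ℕ) (ε : ℝ) : ℝ≥0∞ :=
  ⨆ (E : Set ℝ) (_ : Bornology.IsBounded E ∧ Avoids k ε E), dimH E

/-- Cutting finitely many `E`-free cells out of a grid of `n` cells of width `h` leaves at most
`B.card + 1` runs of cells; subadditivity over these runs with an affine bound on each of them. -/
lemma outerMeasure_inter_Ico_le_of_empty_cells (μ : OuterMeasure ℝ) (E : Set ℝ) {a h α β : ℝ}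
    (hα : 0 ≤ α) (hβ : 0 ≤ β) {K : ℕ}
    (hμ : ∀ m : ℕ, m < K → ∀ b : ℝ, μ (E ∩ Ico b (b + m * h)) ≤ ENNReal.ofReal (α + β * m))
    (B : Finset ℕ) (hB : ∀ q ∈ B, E ∩ Ico (a + q * h) (a + (q + 1) * h) = ∅)
    (n : ℕ) (hn : n ≤ K) (hBn : B ⊆ Finset.range n) (hne : n < K ∨ B.Nonempty) :
    μ (E ∩ Ico a (a + n * h)) ≤ ENNReal.ofReal (α * (B.card + 1) + β * (n - B.card)) := by
  induction B using Finset.induction_on_max generalizing n with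
  | empty => simpa using hμ n (by simpa using hne) a
  | insert x B hx ih =>
    have hxn : x < n := by simpa using hBn (Finset.mem_insert_self x B)
    have hxB : x ∉ B := fun hmem => lt_irrefl x (hx x hmem)
    have left := ih (fun q hq => hB q (Finset.mem_insert_of_mem hq)) x (by omega)
      (fun q hq => Finset.mem_range.2 (hx q hq)) (Or.inl (by omega))
    have right := hμ (n - x - 1) (by omega) (a + (x + 1) * h)
    have cell := hB x (Finset.mem_insert_self x B)
    have hcast : ((n - x - 1 : ℕ) : ℝ) = n - x - 1 := by
      rw [Nat.sub_sub, Nat.cast_sub (by omega)]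
      push_cast
      ring
    have hcard : (B.card : ℝ) ≤ x := by
      have := Finset.card_le_card (fun q hq => Finset.mem_range.2 (hx q hq) : B ⊆ Finset.range x)
      exact_mod_cast (by simpa using this)
    have hxn' : (x : ℝ) + 1 ≤ n := by exact_mod_cast hxn
    have hsub : E ∩ Ico a (a + n * h) ⊆ (E ∩ Ico a (a + x * h)) ∪
        (E ∩ Ico (a + (x + 1) * h) (a + (x + 1) * h + (n - x - 1 : ℕ) * h)) := by
      rintro y ⟨hyE, hy1, hy2⟩
      rcases lt_or_ge y (a + x * h) with h1 | h1
      · exact Or.inl ⟨hyE, hy1, h1⟩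
      rcases lt_or_ge y (a + (x + 1) * h) with h2 | h2
      · exact absurd (show y ∈ E ∩ Ico (a + x * h) (a + (x + 1) * h) from ⟨hyE, h1, h2⟩)
          (by simp [cell])
      · refine Or.inr ⟨hyE, h2, ?_⟩
        rw [hcast]
        linarith
    calc μ (E ∩ Ico a (a + n * h)) ≤ _ := μ.mono hsub
      _ ≤ _ := measure_union_le _ _
      _ ≤ _ := add_le_add left right
      _ = _ := by
        rw [hcast, ← ENNReal.ofReal_add, Finset.card_insert_of_notMem hxB]
        · push_cast
          ring_nf
        · have := mul_nonneg hβ (sub_nonneg.2 hcard)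
          positivity
        · have := mul_nonneg hβ (show (0 : ℝ) ≤ n - x - 1 by linarith)
          positivity

/-- In the subdivision of an interval into `k * M` cells, with `1 / M ≤ ε`, an `ε`-avoiding set
misses one cell in each residue class modulo `M`. -/
lemma Avoids.exists_empty_cells {k M : ℕ} {ε : ℝ} {E : Set ℝ} (hE : Avoids k ε E)
    (hM : 0 < M) (hMε : 1 ≤ ε * M) (a : ℝ) {h : ℝ} (hh : 0 < h) :
    ∃ B : Finset ℕ, B.card = M ∧ B ⊆ Finset.range (k * M) ∧
      ∀ q ∈ B, E ∩ Ico (a + q * h) (a + (q + 1) * h) = ∅ := by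
  have hM' : (0 : ℝ) < M := by exact_mod_cast hM
  choose i hik hi using fun j : ℕ => hE (a + j * h) (M * h) (by positivity)
  have hinj : Set.InjOn (fun j => j + i j * M) (Finset.range M : Finset ℕ) := by
    intro j hj j' hj' hjj
    have := congrArg (· % M) hjj
    simpa [Nat.mod_eq_of_lt (Finset.mem_range.1 hj), Nat.mod_eq_of_lt (Finset.mem_range.1 hj')]
      using this
  refine ⟨(Finset.range M).image fun j => j + i j * M, ?_, ?_, ?_⟩
  · rw [Finset.card_image_of_injOn hinj, Finset.card_range]
  · intro q hq
    obtain ⟨j, hj, rfl⟩ := Finset.mem_image.1 hq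
    rw [Finset.mem_range] at hj ⊢
    calc j + i j * M < M + i j * M := by omega
      _ = (i j + 1) * M := by ring
      _ ≤ k * M := Nat.mul_le_mul_right M (hik j)
  · intro q hq
    obtain ⟨j, -, rfl⟩ := Finset.mem_image.1 hq
    rw [Set.eq_empty_iff_forall_notMem]
    rintro x ⟨hxE, hx1, hx2⟩
    have h1 := hi j x hxE
    push_cast at hx1 hx2
    have h2 : |x - (a + j * h + i j * (M * h))| < h := by
      rw [abs_lt]
      constructor <;> linarith
    nlinarith

/-- If `M ≥ 1 / ε` and `s` solves `(M + 1) ^ (1 - s) * (1 - 1 / k) ^ s = 1`, then an `ε`-avoiding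
set meets every interval of length `L` in a set of `δ`-premeasure at most `L ^ s`. -/
lemma Avoids.pre_inter_Ico_le {k M : ℕ} {ε s : ℝ} {E : Set ℝ} (hE : Avoids k ε E) (hk : 2 ≤ k)
    (hM : 0 < M) (hMε : 1 ≤ ε * M) (hs0 : 0 < s) (hs1 : s ≤ 1)
    (hs : ((M : ℝ) + 1) ^ (1 - s) * (1 - 1 / (k : ℝ)) ^ s = 1) {δ : ℝ} (n : ℕ) :
    ∀ a L : ℝ, 0 ≤ L → L * (1 - 1 / ((k * M : ℕ) : ℝ)) ^ n ≤ δ →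
      OuterMeasure.mkMetric'.pre (fun t : Set ℝ => Metric.ediam t ^ s) (ENNReal.ofReal δ)
        (E ∩ Ico a (a + L)) ≤ ENNReal.ofReal (L ^ s) := by
  have small : ∀ a L : ℝ, 0 ≤ L → L ≤ δ →
      OuterMeasure.mkMetric'.pre (fun t : Set ℝ => Metric.ediam t ^ s) (ENNReal.ofReal δ)
        (E ∩ Ico a (a + L)) ≤ ENNReal.ofReal (L ^ s) := by
    intro a L hL hLδ
    have hd : Metric.ediam (E ∩ Ico a (a + L)) ≤ ENNReal.ofReal L := by
      simpa [Real.ediam_Ico] using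
        Metric.ediam_mono (inter_subset_right : E ∩ Ico a (a + L) ⊆ Ico a (a + L))
    refine (OuterMeasure.mkMetric'.pre_le (hd.trans (ENNReal.ofReal_le_ofReal hLδ))).trans ?_
    rw [← ENNReal.ofReal_rpow_of_nonneg hL hs0.le]
    exact ENNReal.rpow_le_rpow hd hs0.le
  induction n with
  | zero => intro a L hL hLδ; exact small a L hL (by simpa using hLδ)
  | succ n ih =>
    intro a L hL hLδ
    have hK : 0 < k * M := by positivity
    have hK1 : (1 : ℝ) ≤ (k * M : ℕ) := by exact_mod_cast hK
    set K : ℕ := k * M with hKdef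
    have hρ : 0 ≤ 1 - 1 / (K : ℝ) := by
      rw [sub_nonneg, div_le_one (by linarith)]
      exact hK1
    rcases hL.eq_or_lt with rfl | hL0
    · refine small a 0 le_rfl ?_
      simpa using hLδ
    have hk' : (2 : ℝ) ≤ k := by exact_mod_cast hk
    have hM' : (0 : ℝ) < M := by exact_mod_cast hM
    have hr : 0 < 1 - 1 / (k : ℝ) := by
      rw [sub_pos, div_lt_one (by linarith)]
      linarith
    set c : ℝ := (1 - 1 / (k : ℝ)) * L / (M + 1) with hc
    have hc0 : 0 < c := by positivity
    set h : ℝ := L / K with hh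
    have hh0 : 0 < h := by positivity
    have hKh : K * h = L := by rw [hh]; field_simp
    obtain ⟨B, hBcard, hBsub, hB⟩ := hE.exists_empty_cells hM hMε a hh0
    have hcs : 0 < c ^ (1 - s) := by positivity
    have hrun : ∀ m : ℕ, m < K → ∀ b : ℝ,
        OuterMeasure.mkMetric'.pre (fun t : Set ℝ => Metric.ediam t ^ s) (ENNReal.ofReal δ)
          (E ∩ Ico b (b + m * h)) ≤
        ENNReal.ofReal ((1 - s) * c / c ^ (1 - s) + s * h / c ^ (1 - s) * m) := by
      intro m hm b
      have hm' : (m : ℝ) + 1 ≤ K := by exact_mod_cast hm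
      refine (ih b (m * h) (by positivity) (le_trans ?_ hLδ)).trans
        (ENNReal.ofReal_le_ofReal ?_)
      · rw [pow_succ, mul_comm ((1 - 1 / (K : ℝ)) ^ n), ← mul_assoc]
        refine mul_le_mul_of_nonneg_right ?_ (by positivity)
        calc m * h ≤ (K - 1) * h := by gcongr; linarith
          _ = L * (1 - 1 / K) := by rw [← hKh]; field_simp
      · have := Real.geom_mean_le_arith_mean2_weighted hs0.le (sub_nonneg.2 hs1)
          (show 0 ≤ m * h by positivity) hc0.le (by ring)
        calc (m * h) ^ s ≤ (s * (m * h) + (1 - s) * c) / c ^ (1 - s) := by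
              rwa [le_div_iff₀ hcs]
          _ = _ := by ring
    have hs1' : 0 ≤ 1 - s := sub_nonneg.2 hs1
    have key := outerMeasure_inter_Ico_le_of_empty_cells _ E (a := a)
      (by positivity) (by positivity) hrun B hB K le_rfl hBsub
      (Or.inr (Finset.card_pos.1 (by omega)))
    rw [hKh, hBcard] at key
    refine key.trans_eq (congrArg _ ?_)
    have hlen : h * (K - M) = (M + 1) * c := by
      rw [hc, hh, hKdef]
      push_cast
      field_simp
    have hcsplit : c = c ^ s * c ^ (1 - s) := by
      rw [← Real.rpow_add hc0]
      simp
    have hMs : (M : ℝ) + 1 = (M + 1) ^ s * (M + 1) ^ (1 - s) := by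
      rw [← Real.rpow_add (by positivity)]
      simp
    calc (1 - s) * c / c ^ (1 - s) * (M + 1) + s * h / c ^ (1 - s) * (K - M)
        = ((1 - s) * c * (M + 1) + s * (h * (K - M))) / c ^ (1 - s) := by ring
      _ = (M + 1) * (c / c ^ (1 - s)) := by rw [hlen]; ring
      _ = (M + 1) * c ^ s := by
          congr 1
          rw [div_eq_iff hcs.ne']
          exact hcsplit
      _ = (M + 1) ^ (1 - s) * (1 - 1 / (k : ℝ)) ^ s * L ^ s := by
          rw [hc, Real.div_rpow (by positivity) (by positivity), Real.mul_rpow hr.le hL]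
          nth_rewrite 1 [hMs]
          field_simp
      _ = L ^ s := by rw [hs, one_mul]

lemma Avoids.dimH_le {k M : ℕ} {ε s : ℝ} {E : Set ℝ} (hE : Avoids k ε E)
    (hbdd : Bornology.IsBounded E) (hk : 2 ≤ k)
    (hM : 0 < M) (hMε : 1 ≤ ε * M) (hs0 : 0 < s) (hs1 : s ≤ 1)
    (hs : ((M : ℝ) + 1) ^ (1 - s) * (1 - 1 / (k : ℝ)) ^ s = 1) :
    dimH E ≤ ENNReal.ofReal s := by
  obtain ⟨R, hR0, hR⟩ := hbdd.subset_ball_lt 0 0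
  have hEsub : E ⊆ Ico (-R) (-R + 2 * R) := fun x hx => by
    have := hR hx
    rw [Real.ball_eq_Ioo] at this
    exact ⟨by linarith [this.1], by linarith [this.2]⟩
  have hK : (1 : ℝ) ≤ (k * M : ℕ) := by exact_mod_cast (by positivity : 0 < k * M)
  have hρ0 : 0 ≤ 1 - 1 / ((k * M : ℕ) : ℝ) := by
    rw [sub_nonneg, div_le_one (by linarith)]
    exact hK
  have hρ1 : 1 - 1 / ((k * M : ℕ) : ℝ) < 1 := by
    have : 0 < 1 / ((k * M : ℕ) : ℝ) := by positivity
    linarith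
  refine dimH_le_of_hausdorffMeasure_ne_top (d := s.toNNReal) ?_
  rw [Real.coe_toNNReal s hs0.le]
  refine ne_top_of_le_ne_top (ENNReal.ofReal_ne_top (r := (2 * R) ^ s)) ?_
  have heq : (Measure.hausdorffMeasure s : Measure ℝ) E =
      (⨆ r > 0, OuterMeasure.mkMetric'.pre (fun t : Set ℝ => Metric.ediam t ^ s) r) E := by
    rw [← Measure.coe_toOuterMeasure, Measure.hausdorffMeasure, Measure.mkMetric_toOuterMeasure]
    rfl
  rw [heq]
  simp only [OuterMeasure.iSup_apply]
  refine iSup₂_le fun r hr => ?_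
  obtain ⟨δ, hδ0, hδr⟩ : ∃ δ : ℝ, 0 < δ ∧ ENNReal.ofReal δ ≤ r := by
    obtain ⟨q, hq0, hqr⟩ := ENNReal.lt_iff_exists_nnreal_btwn.1 hr
    exact ⟨q, by exact_mod_cast hq0, by simpa using hqr.le⟩
  obtain ⟨n, hn⟩ := exists_pow_lt_of_lt_one (show 0 < δ / (2 * R) by positivity) hρ1
  rw [lt_div_iff₀ (by positivity)] at hn
  refine (OuterMeasure.mkMetric'.mono_pre _ hδr E).trans ?_
  rw [← inter_eq_left.2 hEsub]
  exact hE.pre_inter_Ico_le hk hM hMε hs0 hs1 hs n (-R) (2 * R) (by positivity) (by linarith)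

theorem stmt3 (k : ℕ) (hk : 3 ≤ k) (ε : ℝ) (hε0 : 0 < ε) (hε1 : ε < 1 / 10) :
    dAvoid k ε ≤
      ENNReal.ofReal (Real.log (⌈1 / ε⌉₊ + 1) /
        (Real.log (⌈1 / ε⌉₊ + 1) - Real.log (1 - 1 / k))) := by
  refine iSup₂_le fun E hE => ?_
  have hM : 0 < ⌈1 / ε⌉₊ := Nat.ceil_pos.2 (by positivity)
  have hMε : 1 ≤ ε * ⌈1 / ε⌉₊ := by
    have := (div_le_iff₀ hε0).1 (Nat.le_ceil (1 / ε))
    linarith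
  have hk' : (3 : ℝ) ≤ k := by exact_mod_cast hk
  have hM' : (0 : ℝ) < ⌈1 / ε⌉₊ := by exact_mod_cast hM
  have hr0 : 0 < 1 - 1 / (k : ℝ) := by
    rw [sub_pos, div_lt_one (by linarith)]
    linarith
  have hr1 : 1 - 1 / (k : ℝ) < 1 := by
    have : 0 < 1 / (k : ℝ) := by positivity
    linarith
  have hlogN : 0 < Real.log (⌈1 / ε⌉₊ + 1) := Real.log_pos (by linarith)
  have hlogr : Real.log (1 - 1 / k) < 0 := Real.log_neg hr0 hr1
  refine hE.2.dimH_le hE.1 (by omega) hM hMε (div_pos hlogN (by linarith)) ?_ ?_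
  · rw [div_le_one (by linarith)]
    linarith
  · rw [Real.rpow_def_of_pos (by positivity), Real.rpow_def_of_pos hr0, ← Real.exp_add,
      Real.exp_eq_one_iff]
    have hne : Real.log (⌈1 / ε⌉₊ + 1) - Real.log (1 - 1 / k) ≠ 0 := by linarith
    generalize Real.log (⌈1 / ε⌉₊ + 1) = A at *
    generalize Real.log (1 - 1 / (k : ℝ)) = C at *
    field_simp
    ring
end

section
/- Let k ≥ 3, let ε > 0, and let m be an integer with k < m and 1/m < ε. Set N = m². If E ⊆ [0,1] ε-avoids k-APs, then for every integer j ≥ 0 and every N-adic interval I of length N^{−j} contained in [0,1], the number of N-adic subintervals of I of length N^{−(j+1)} that intersect E is strictly less than m·(r_k(m) + 1). -/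
open Set

/-- `rk k N` is the maximal cardinality of a subset of `{1, …, N}` without
`k`-term arithmetic progressions. -/
noncomputable def rk (k N : ℕ) : ℕ :=
  sSup {m : ℕ | ∃ A : Finset ℕ, A ⊆ Finset.Icc 1 N ∧ ¬ ContainsAPNat k A ∧ A.card = m}

theorem card_le_rk {k M : ℕ} {A : Finset ℕ} (hA : A ⊆ Finset.Icc 1 M)
    (hAP : ¬ ContainsAPNat k A) : A.card ≤ rk k M := by
  refine le_csSup ⟨M, ?_⟩ ⟨A, hA, hAP, rfl⟩
  rintro _ ⟨B, hB, -, rfl⟩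
  simpa using Finset.card_le_card hB

/-- A set that `ε`-avoids `k`-APs cannot meet every one of `k` intervals of length `δ` whose
left endpoints form a progression of gap `lam`, if `δ < ε * lam`. -/
theorem Avoids.exists_Icc_inter_empty {k : ℕ} {ε : ℝ} {E : Set ℝ} (hE : Avoids k ε E)
    {lam δ : ℝ} (hlam : 0 < lam) (hδ : δ < ε * lam) (p : ℝ) :
    ∃ i < k, ¬ (Set.Icc (p + i * lam) (p + i * lam + δ) ∩ E).Nonempty := by
  obtain ⟨i, hi, h⟩ := hE p lam hlam
  refine ⟨i, hi, ?_⟩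
  rintro ⟨x, ⟨hx₁, hx₂⟩, hxE⟩
  have := h x hxE
  rw [abs_of_nonneg (by linarith)] at this
  linarith

/-- In each residue class modulo `m`, at most `rk k m` of the `m ^ 2` consecutive intervals of
length `δ` starting at `a * m ^ 2 * δ` meet a set that `ε`-avoids `k`-APs. -/
theorem Avoids.card_residue_le_rk {k m : ℕ} {ε δ : ℝ} {E : Set ℝ} (hE : Avoids k ε E)
    (hm : 0 < m) (hmε : 1 / (m : ℝ) < ε) (hδ : 0 < δ) (a r : ℕ) {F : Finset ℕ}
    (hF : ∀ b ∈ F, a * m ^ 2 ≤ b ∧ b < (a + 1) * m ^ 2 ∧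
      (Set.Icc ((b : ℝ) * δ) (((b : ℝ) + 1) * δ) ∩ E).Nonempty)
    (hr : ∀ b ∈ F, b % m = r) : F.card ≤ rk k m := by
  have hdiv : ∀ b ∈ F, a * m ≤ b / m ∧ b / m < (a + 1) * m := by
    intro b hb
    obtain ⟨h₁, h₂, -⟩ := hF b hb
    rw [Nat.le_div_iff_mul_le hm, Nat.div_lt_iff_lt_mul hm]
    constructor <;> nlinarith
  have hinj : Set.InjOn (fun b => b / m - a * m + 1) (F : Set ℕ) := by
    intro b hb c hc hbc
    have hb₁ := (hdiv b hb).1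
    have hc₁ := (hdiv c hc).1
    have hq : b / m = c / m := by simp only at hbc; omega
    rw [← Nat.div_add_mod b m, ← Nat.div_add_mod c m, hq, hr b hb, hr c hc]
  rw [← Finset.card_image_of_injOn hinj]
  apply card_le_rk
  · intro q hq
    obtain ⟨b, hb, rfl⟩ := Finset.mem_image.1 hq
    have := hdiv b hb
    rw [add_mul] at this
    rw [Finset.mem_Icc]
    omega
  · rintro ⟨q, d, hd, hAP⟩
    have hm' : (0 : ℝ) < m := by exact_mod_cast hm
    have hd' : (1 : ℝ) ≤ d := by exact_mod_cast hd
    have hgap : δ < ε * (m * d * δ) := by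
      have h₁ : 1 < ε * m := (div_lt_iff₀ hm').1 hmε
      have h₂ : 1 < ε * m * d := by nlinarith
      nlinarith
    obtain ⟨i, hi, hempty⟩ := hE.exists_Icc_inter_empty (lam := m * d * δ) (by positivity) hgap
      ((m * (a * m + q - 1) + r) * δ)
    obtain ⟨b, hb, hbq⟩ := Finset.mem_image.1 (hAP i hi)
    have hb₁ := (hdiv b hb).1
    have hquot : b / m + 1 = a * m + q + i * d := by omega
    have hbr : m * (b / m) + r = b := by rw [← hr b hb]; exact Nat.div_add_mod b m
    have hquot' : ((b / m : ℕ) : ℝ) = a * m + q + i * d - 1 := by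
      rw [eq_sub_iff_add_eq]; exact_mod_cast hquot
    have hb' : (b : ℝ) = m * (a * m + q + i * d - 1) + r := by
      rw [← hquot']; exact_mod_cast hbr.symm
    apply hempty
    convert (hF b hb).2.2 using 3 <;> rw [hb'] <;> ring

theorem stmt11 (k : ℕ) (hk : 3 ≤ k) (ε : ℝ) (hε : 0 < ε) (m : ℕ) (hkm : k < m)
    (hmε : 1 / (m : ℝ) < ε) (N : ℕ) (hN : N = m ^ 2)
    (E : Set ℝ) (hEsub : E ⊆ Set.Icc 0 1) (hEav : Avoids k ε E)
    (j a : ℕ)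
    (hI : Set.Icc ((a : ℝ) * (N : ℝ) ^ (-(j : ℤ))) (((a : ℝ) + 1) * (N : ℝ) ^ (-(j : ℤ))) ⊆
      Set.Icc 0 1) :
    {b : ℕ | a * N ≤ b ∧ b < (a + 1) * N ∧
        (Set.Icc ((b : ℝ) * (N : ℝ) ^ (-(j : ℤ) - 1)) (((b : ℝ) + 1) * (N : ℝ) ^ (-(j : ℤ) - 1)) ∩
          E).Nonempty}.ncard <
      m * (rk k m + 1) := by
  subst hN
  have hm : 0 < m := by omega
  have hδ : (0 : ℝ) < ((m ^ 2 : ℕ) : ℝ) ^ (-(j : ℤ) - 1) := by positivity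
  set S := {b : ℕ | a * m ^ 2 ≤ b ∧ b < (a + 1) * m ^ 2 ∧
    (Set.Icc ((b : ℝ) * ((m ^ 2 : ℕ) : ℝ) ^ (-(j : ℤ) - 1))
      (((b : ℝ) + 1) * ((m ^ 2 : ℕ) : ℝ) ^ (-(j : ℤ) - 1)) ∩ E).Nonempty} with hS
  have hfin : S.Finite := (Set.finite_Iio ((a + 1) * m ^ 2)).subset fun b hb => hb.2.1
  rw [Set.ncard_eq_toFinset_card S hfin]
  have hfiber : hfin.toFinset.card ≤ rk k m * (Finset.range m).card := by
    refine Finset.card_le_mul_card_image_of_maps_to (f := fun b => b % m)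
      (fun b _ => Finset.mem_range.2 (Nat.mod_lt b hm)) _ fun r _ => ?_
    refine hEav.card_residue_le_rk hm hmε hδ a r (fun b hb => ?_) fun b hb => ?_
    · exact hfin.mem_toFinset.1 (Finset.mem_filter.1 hb).1
    · exact (Finset.mem_filter.1 hb).2
  rw [Finset.card_range] at hfiber
  nlinarith
end
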